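/- arXiv:1508.02235 — 2 statements merged into one kernel-verified Lean document; each statement's English description precedes it below -/
import Mathlib

section
/- Let (Ω, 𝒜, (ℱ_t)_{t≥0}, P) be a filtered probability space, let x ∈ ℝ^d, u ∈ ℝ^d, and let X : [0,∞) → Ω → ℝ^d be an adapted process with right-continuous paths such that X(0) = x P-almost surely. Let q : ℝ^d × ℝ^d → ℂ be continuous with x' ↦ q(x',u) bounded, and assume that the process M_u(t) := e^{i⟨u, X(t)⟩} − ∫₀ᵗ e^{i⟨u, X(s)⟩} q(X(s), u) ds, t ≥ 0, is a martingale with respect to (ℱ_t) and P. Then lim_{t ↘ 0} (E[e^{i⟨u, X(t) − x⟩}] − 1)/t = q(x, u). -/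
open MeasureTheory Filter

theorem tendsto_floor_succ_div_nhdsGE (s : ℝ) :
    Tendsto (fun n : ℕ => ((⌊((n : ℝ) + 1) * s⌋ : ℝ) + 1) / ((n : ℝ) + 1)) atTop
      (nhdsWithin s (Set.Ici s)) := by
  have hlow : ∀ n : ℕ, s ≤ ((⌊((n : ℝ) + 1) * s⌋ : ℝ) + 1) / ((n : ℝ) + 1) := fun n => by
    rw [le_div_iff₀ (by positivity)]
    linarith [Int.lt_floor_add_one (((n : ℝ) + 1) * s)]
  refine tendsto_nhdsWithin_iff.2 ⟨?_, Eventually.of_forall hlow⟩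
  have hlim : Tendsto (fun n : ℕ => s + 1 / ((n : ℝ) + 1)) atTop (nhds s) := by
    simpa using tendsto_const_nhds.add (tendsto_one_div_add_atTop_nhds_zero_nat (𝕜 := ℝ))
  refine tendsto_of_tendsto_of_tendsto_of_le_of_le tendsto_const_nhds hlim hlow fun n => ?_
  have hn : (0 : ℝ) < (n : ℝ) + 1 := by positivity
  have hfloor := Int.floor_le (((n : ℝ) + 1) * s)
  change _ ≤ s + 1 / ((n : ℝ) + 1)
  rw [div_le_iff₀ hn, add_mul s, one_div_mul_cancel hn.ne']
  linarith

theorem measurable_of_continuousWithinAt_Ici {E : Type*} [TopologicalSpace E]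
    [TopologicalSpace.PseudoMetrizableSpace E] [MeasurableSpace E] [BorelSpace E] {f : ℝ → E}
    (hf : ∀ s, ContinuousWithinAt f (Set.Ici s) s) : Measurable f := by
  refine measurable_of_tendsto_metrizable
    (f := fun (n : ℕ) s => f (((⌊((n : ℝ) + 1) * s⌋ : ℝ) + 1) / ((n : ℝ) + 1)))
    (fun n => ?_) (tendsto_pi_nhds.2 fun s => (hf s).tendsto.comp (tendsto_floor_succ_div_nhdsGE s))
  exact (measurable_of_countable fun k : ℤ => f (((k : ℝ) + 1) / ((n : ℝ) + 1))).comp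
    (Int.measurable_floor.comp (measurable_const_mul _))

/-- Right-continuity on `[0, ∞)` gives the right derivative of the integral at `0`. -/
theorem tendsto_integral_div_of_rightContinuous {f : ℝ → ℂ}
    (hf : ∀ t, 0 ≤ t → ContinuousWithinAt f (Set.Ici t) t) :
    Tendsto (fun t : ℝ => (∫ s in (0 : ℝ)..t, f s) / (t : ℂ))
      (nhdsWithin 0 (Set.Ioi 0)) (nhds (f 0)) := by
  have hmeas : Measurable fun s => f (max s 0) :=
    measurable_of_continuousWithinAt_Ici fun s =>
      (hf (max s 0) (le_max_right _ _)).comp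
        (f := fun r : ℝ => max r 0) (by fun_prop) fun r hr => Set.mem_Ici.2 (max_le_max_right 0 hr)
  have hsm : StronglyMeasurableAtFilter f (nhdsWithin 0 (Set.Ioi 0)) volume := by
    refine ⟨Set.Ioi 0, self_mem_nhdsWithin, ?_⟩
    refine hmeas.aestronglyMeasurable.congr ?_
    filter_upwards [ae_restrict_mem measurableSet_Ioi] with s hs
    rw [max_eq_left (le_of_lt hs)]
  have hder : HasDerivWithinAt (fun t => ∫ s in (0 : ℝ)..t, f s) (f 0) (Set.Ici 0) 0 :=
    intervalIntegral.integral_hasDerivWithinAt_right (by simp) hsm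
      ((hf 0 le_rfl).mono Set.Ioi_subset_Ici_self)
  have hslope := hasDerivWithinAt_iff_tendsto_slope.1 hder
  rw [Set.Ici_sdiff_left] at hslope
  refine hslope.congr fun t => ?_
  simp [slope_def_module, div_eq_inv_mul]

/-- if `X` is adapted with right-continuous paths, `X(0) = x`
a.s., `q` is continuous with `x' ↦ q(x',u)` bounded, and
`M_u(t) = e^{i⟨u,X(t)⟩} − ∫₀ᵗ e^{i⟨u,X(s)⟩} q(X(s),u) ds` is a martingale, then
`lim_{t↘0} (E[e^{i⟨u,X(t)−x⟩}] − 1)/t = q(x,u)`. -/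
theorem stmt_16 {Ω : Type*} [m : MeasurableSpace Ω] (P : Measure Ω)
    [IsProbabilityMeasure P] (ℱ : Filtration ℝ m) (d : ℕ)
    (x u : EuclideanSpace ℝ (Fin d))
    (X : ℝ → Ω → EuclideanSpace ℝ (Fin d))
    (hX_adapted : ∀ t : ℝ, StronglyMeasurable[ℱ t] (X t))
    (hX_rc : ∀ ω, ∀ t, 0 ≤ t → ContinuousWithinAt (fun s => X s ω) (Set.Ici t) t)
    (hX0 : ∀ᵐ ω ∂P, X 0 ω = x)
    (q : EuclideanSpace ℝ (Fin d) → EuclideanSpace ℝ (Fin d) → ℂ)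
    (hq_cont : Continuous fun p : EuclideanSpace ℝ (Fin d) × EuclideanSpace ℝ (Fin d) => q p.1 p.2)
    (K : ℝ) (hq_bdd : ∀ y, ‖q y u‖ ≤ K)
    (M : ℝ → Ω → ℂ)
    (hM : ∀ t ω, M t ω =
      Complex.exp (Complex.I * ((inner ℝ u (X t ω) : ℝ) : ℂ)) -
        ∫ s in (0:ℝ)..t,
          Complex.exp (Complex.I * ((inner ℝ u (X s ω) : ℝ) : ℂ)) * q (X s ω) u)
    (hM_adapted : ∀ t, 0 ≤ t → StronglyMeasurable[ℱ t] (M t))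
    (hM_int : ∀ t, 0 ≤ t → Integrable (M t) P)
    (hM_mart : ∀ s t : ℝ, 0 ≤ s → s ≤ t → P[M t|ℱ s] =ᵐ[P] M s) :
    Tendsto
      (fun t : ℝ =>
        ((∫ ω, Complex.exp (Complex.I * ((inner ℝ u (X t ω - x) : ℝ) : ℂ)) ∂P) - 1) / (t : ℂ))
      (nhdsWithin 0 (Set.Ioi 0)) (nhds (q x u)) := by
  set Y : ℝ → Ω → ℂ := fun t ω => Complex.exp (Complex.I * ((inner ℝ u (X t ω) : ℝ) : ℂ)) with hY
  set c : ℂ := Complex.exp (Complex.I * ((inner ℝ u x : ℝ) : ℂ)) with hc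
  set A : ℝ → Ω → ℂ := fun t ω => ∫ s in (0 : ℝ)..t, Y s ω * q (X s ω) u with hA
  have hMA : ∀ t ω, M t ω = Y t ω - A t ω := hM
  have hYnorm : ∀ t ω, ‖Y t ω‖ = 1 := fun t ω => by
    simp only [hY, mul_comm Complex.I, Complex.norm_exp_ofReal_mul_I]
  have hexp : Continuous fun y : EuclideanSpace ℝ (Fin d) =>
      Complex.exp (Complex.I * ((inner ℝ u y : ℝ) : ℂ)) := by fun_prop
  have hYint : ∀ t, Integrable (Y t) P := fun t =>
    Integrable.of_bound (hexp.comp_stronglyMeasurable ((hX_adapted t).mono (ℱ.le t))).aestronglyMeasurable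
      1 (Eventually.of_forall fun ω => (hYnorm t ω).le)
  have hAint : ∀ t, 0 ≤ t → Integrable (A t) P := fun t ht =>
    ((hYint t).sub (hM_int t ht)).congr (Eventually.of_forall fun ω => by simp [hMA])
  have hM0 : ∫ ω, M 0 ω ∂P = c := by
    rw [integral_congr_ae (g := fun _ => c)]
    · simp
    · filter_upwards [hX0] with ω hω
      simp [hM, hω, hc]
  have hA_mean : ∀ t, 0 ≤ t → ∫ ω, A t ω ∂P = (∫ ω, Y t ω ∂P) - c := fun t ht => by
    have hmean : ∫ ω, M t ω ∂P = c := by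
      rw [← hM0, ← integral_condExp (ℱ.le 0), integral_congr_ae (hM_mart 0 t le_rfl ht)]
    have hsub : ∫ ω, M t ω ∂P = (∫ ω, Y t ω ∂P) - ∫ ω, A t ω ∂P := by
      rw [← integral_sub (hYint t) (hAint t ht)]
      simp only [hMA]
    rw [← hmean, hsub]
    ring
  have hqu : Continuous fun y => q y u := hq_cont.comp (by fun_prop : Continuous fun y => (y, u))
  have hlim : Tendsto (fun t : ℝ => ∫ ω, A t ω / (t : ℂ) ∂P) (nhdsWithin 0 (Set.Ioi 0))
      (nhds (∫ _, c * q x u ∂P)) := by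
    refine tendsto_integral_filter_of_dominated_convergence (fun _ => K) ?_ ?_
      (integrable_const K) ?_
    · filter_upwards [self_mem_nhdsWithin] with t ht
      exact ((hAint t (le_of_lt ht)).div_const _).aestronglyMeasurable
    · filter_upwards [self_mem_nhdsWithin] with t ht
      have ht : 0 < t := ht
      refine Eventually.of_forall fun ω => ?_
      have hbound : ‖A t ω‖ ≤ K * |t - 0| :=
        intervalIntegral.norm_integral_le_of_norm_le_const fun s _ => by
          rw [norm_mul, hYnorm, one_mul]
          exact hq_bdd _
      rw [norm_div, Complex.norm_real, Real.norm_eq_abs, div_le_iff₀ (abs_pos.2 ht.ne')]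
      simpa using hbound
    · filter_upwards [hX0] with ω hω
      have h := tendsto_integral_div_of_rightContinuous (f := fun s => Y s ω * q (X s ω) u)
        fun t ht => (hexp.mul hqu).continuousAt.comp_continuousWithinAt (hX_rc ω t ht)
      simpa only [hY, hω] using h
  have hcc : c⁻¹ * c = 1 := inv_mul_cancel₀ (Complex.exp_ne_zero _)
  have hscaled := hlim.const_mul c⁻¹
  rw [integral_const, probReal_univ, one_smul, ← mul_assoc, hcc, one_mul] at hscaled
  refine hscaled.congr' ?_
  filter_upwards [self_mem_nhdsWithin] with t ht
  have hshift : ∀ ω, Complex.exp (Complex.I * ((inner ℝ u (X t ω - x) : ℝ) : ℂ)) =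
      c⁻¹ * Y t ω := fun ω => by
    rw [hc, ← Complex.exp_neg, hY, ← Complex.exp_add, inner_sub_right]
    push_cast
    ring_nf
  simp only [hshift]
  rw [integral_const_mul, integral_div, hA_mean t (le_of_lt ht), mul_div_assoc', mul_sub, hcc]
end

section
/- Let (Ω, 𝒜, (ℱ_t)_{t≥0}, P) be a filtered probability space and let h : [0,∞) → Ω → ℂ be jointly measurable, adapted, and bounded (|h(s,ω)| ≤ K for some constant K). If the process M(t)(ω) := ∫₀ᵗ h(s)(ω) ds, t ≥ 0, is a martingale with respect to (ℱ_t) and P, then for P-almost every ω, h(s)(ω) = 0 for Lebesgue-almost every s ≥ 0. In particular, if a process X with symbol candidates q₁, q₂ satisfies that both t ↦ e^{i⟨u,X(t)⟩} − ∫₀ᵗ e^{i⟨u,X(s)⟩} q_j(X(s),u) ds (j = 1,2) are martingales, then for P-almost every ω, q₁(X(s,ω),u) = q₂(X(s,ω),u) for Lebesgue-almost every s ≥ 0. -/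
open MeasureTheory Filter

/-- A real function with increments bounded by a multiple of the squared distance is constant. -/
theorem eq_of_norm_sub_le_mul_sq {E : Type*} [NormedAddCommGroup E] [NormedSpace ℝ E]
    {f : ℝ → E} {C : ℝ} (hf : ∀ x y, ‖f x - f y‖ ≤ C * (x - y) ^ 2) (x y : ℝ) : f x = f y := by
  have hderiv (z : ℝ) : HasFDerivAt f (0 : ℝ →L[ℝ] E) z := by
    have hO : (fun x => f x - f z) =O[nhds z] fun x => ‖x - z‖ ^ 2 :=
      .of_bound C <| .of_forall fun x => by simpa using hf x z
    simpa using (hO.hasFDerivAt one_lt_two).add_const (f z)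
  exact is_const_of_fderiv_eq_zero (𝕜 := ℝ) (fun z => (hderiv z).differentiableAt)
    (fun z => (hderiv z).fderiv) x y

/-- The Pythagorean identity for the conditional expectation of a bounded random vector. -/
theorem integral_norm_sub_sq_of_condExp_ae_eq {Ω E : Type*} {m m₀ : MeasurableSpace Ω}
    {μ : Measure Ω} [IsFiniteMeasure μ] [NormedAddCommGroup E] [InnerProductSpace ℝ E]
    [CompleteSpace E] {f g : Ω → E} {a b : ℝ} (hm : m ≤ m₀)
    (hf : StronglyMeasurable[m] f) (hg : AEStronglyMeasurable g μ)
    (hfa : ∀ ω, ‖f ω‖ ≤ a) (hgb : ∀ ω, ‖g ω‖ ≤ b) (hfg : μ[g|m] =ᵐ[μ] f) :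
    ∫ ω, ‖g ω - f ω‖ ^ 2 ∂μ = ∫ ω, ‖g ω‖ ^ 2 ∂μ - ∫ ω, ‖f ω‖ ^ 2 ∂μ := by
  have hf' : AEStronglyMeasurable f μ := (hf.mono hm).aestronglyMeasurable
  have hg_int : Integrable g μ := .of_bound hg b (.of_forall hgb)
  have hf_sq : Integrable (fun ω => ‖f ω‖ ^ 2) μ := by
    refine .of_bound (hf'.norm.pow 2) (a ^ 2) (.of_forall fun ω => ?_)
    simpa using pow_le_pow_left₀ (norm_nonneg _) (hfa ω) 2
  have hg_sq : Integrable (fun ω => ‖g ω‖ ^ 2) μ := by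
    refine .of_bound (hg.norm.pow 2) (b ^ 2) (.of_forall fun ω => ?_)
    simpa using pow_le_pow_left₀ (norm_nonneg _) (hgb ω) 2
  have hinner : Integrable (fun ω => inner ℝ (f ω) (g ω)) μ := by
    refine .of_bound (hf'.inner hg) (a * b) (.of_forall fun ω => ?_)
    exact (norm_inner_le_norm _ _).trans <|
      mul_le_mul (hfa ω) (hgb ω) (norm_nonneg _) ((norm_nonneg _).trans (hfa ω))
  have horth : ∫ ω, inner ℝ (f ω) (g ω) ∂μ = ∫ ω, ‖f ω‖ ^ 2 ∂μ := by
    rw [← integral_condExp hm]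
    refine integral_congr_ae ?_
    filter_upwards [condExp_stronglyMeasurable_bilin_of_bound (innerSL ℝ) hm hf hg_int a
      (.of_forall hfa), hfg] with ω h₁ h₂
    exact h₁.trans (by rw [h₂]; exact real_inner_self_eq_norm_sq _)
  have hexp : ∀ ω, ‖g ω - f ω‖ ^ 2 = ‖g ω‖ ^ 2 - 2 * inner ℝ (f ω) (g ω) + ‖f ω‖ ^ 2 :=
    fun ω => by rw [norm_sub_sq_real, real_inner_comm]
  simp_rw [hexp]
  rw [integral_add (f := fun ω => ‖g ω‖ ^ 2 - 2 * inner ℝ (f ω) (g ω))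
      (hg_sq.sub (hinner.const_mul 2)) hf_sq,
    integral_sub hg_sq (hinner.const_mul 2), integral_const_mul, horth]
  ring

/-- A locally integrable function on the line whose primitive from `0` vanishes on `[0, ∞)`
vanishes almost everywhere on `[0, ∞)`. -/
theorem ae_restrict_Ici_eq_zero_of_integral_eq_zero {E : Type*} [NormedAddCommGroup E]
    [NormedSpace ℝ E] [CompleteSpace E] {f : ℝ → E} (hf : LocallyIntegrable f volume)
    (h0 : ∀ t, 0 ≤ t → ∫ s in (0:ℝ)..t, f s = 0) :
    ∀ᵐ s ∂(volume.restrict (Set.Ici (0:ℝ))), f s = 0 := by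
  rw [← Measure.restrict_congr_set Ioi_ae_eq_Ici, ae_restrict_iff' measurableSet_Ioi]
  filter_upwards [LocallyIntegrable.ae_hasDerivAt_integral hf] with x hx hx0
  have hev : (fun t => ∫ s in (0:ℝ)..t, f s) =ᶠ[nhds x] fun _ => 0 := by
    filter_upwards [Ioi_mem_nhds hx0] with t ht using h0 t ht.le
  exact ((hx 0).congr_of_eventuallyEq hev.symm).unique (hasDerivAt_const x 0)

/-- If the time integral of a bounded jointly measurable process is a martingale, then the
process vanishes almost surely for almost every time. -/
theorem ae_eq_zero_of_martingale_integral {Ω E : Type*} [m : MeasurableSpace Ω] {P : Measure Ω}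
    [IsFiniteMeasure P] {ℱ : Filtration ℝ m} [NormedAddCommGroup E] [InnerProductSpace ℝ E]
    [CompleteSpace E] {h : ℝ → Ω → E}
    (hh_meas : StronglyMeasurable fun p : ℝ × Ω => h p.1 p.2)
    {K : ℝ} (hh_bdd : ∀ s ω, ‖h s ω‖ ≤ K)
    (hM_adapted : ∀ t, 0 ≤ t → StronglyMeasurable[ℱ t] fun ω => ∫ s in (0:ℝ)..t, h s ω)
    (hM_mart : ∀ s t : ℝ, 0 ≤ s → s ≤ t →
      P[(fun ω => ∫ r in (0:ℝ)..t, h r ω)|ℱ s] =ᵐ[P] fun ω => ∫ r in (0:ℝ)..s, h r ω) :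
    ∀ᵐ ω ∂P, ∀ᵐ s ∂(volume.restrict (Set.Ici (0:ℝ))), h s ω = 0 := by
  have hloc (ω : Ω) : LocallyIntegrable (fun s => h s ω) volume :=
    (locallyIntegrable_const K).mono
      (hh_meas.comp_measurable measurable_prodMk_right).aestronglyMeasurable
      (.of_forall fun s => (hh_bdd s ω).trans (le_abs_self K))
  have hint (ω : Ω) (a b : ℝ) : IntervalIntegrable (fun s => h s ω) volume a b :=
    ((hloc ω).integrableOn_isCompact isCompact_uIcc).intervalIntegrable
  set M : ℝ → Ω → E := fun t ω => ∫ s in (0:ℝ)..t, h s ω with hM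
  have hM_inc (s t : ℝ) (ω : Ω) : ‖M t ω - M s ω‖ ≤ K * |t - s| := by
    rw [hM, intervalIntegral.integral_interval_sub_left (hint ω _ _) (hint ω _ _)]
    exact intervalIntegral.norm_integral_le_of_norm_le_const fun r _ => hh_bdd r ω
  have hM_zero (ω : Ω) : M 0 ω = 0 := intervalIntegral.integral_same
  have hM_bdd (t : ℝ) (ω : Ω) : ‖M t ω‖ ≤ K * |t| := by
    simpa [hM_zero] using hM_inc 0 t ω
  have hM_meas (t : ℝ) (ht : 0 ≤ t) : StronglyMeasurable (M t) :=
    (hM_adapted t ht).mono (ℱ.le t)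
  have hsq_le (s t : ℝ) (hs : 0 ≤ s) (hst : s ≤ t) :
      ‖∫ ω, ‖M t ω‖ ^ 2 ∂P - ∫ ω, ‖M s ω‖ ^ 2 ∂P‖ ≤ K ^ 2 * P.real Set.univ * (t - s) ^ 2 := by
    rw [← integral_norm_sub_sq_of_condExp_ae_eq (ℱ.le s) (hM_adapted s hs)
      (hM_meas t (hs.trans hst)).aestronglyMeasurable (hM_bdd s) (hM_bdd t) (hM_mart s t hs hst)]
    refine (norm_integral_le_of_norm_le_const (C := (K * |t - s|) ^ 2)
      (.of_forall fun ω => ?_)).trans_eq ?_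
    · simpa using pow_le_pow_left₀ (norm_nonneg _) (hM_inc s t ω) 2
    · rw [mul_pow, sq_abs]; ring
  have habs (s t : ℝ) : ‖∫ ω, ‖M |s| ω‖ ^ 2 ∂P - ∫ ω, ‖M |t| ω‖ ^ 2 ∂P‖
      ≤ K ^ 2 * P.real Set.univ * (s - t) ^ 2 := by
    have hle : (|s| - |t|) ^ 2 ≤ (s - t) ^ 2 := sq_le_sq.2 (abs_abs_sub_abs_le s t)
    refine le_trans ?_ (mul_le_mul_of_nonneg_left hle (by positivity))
    rcases le_total |t| |s| with hts | hst
    · exact hsq_le _ _ (abs_nonneg _) hts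
    · rw [norm_sub_rev, ← neg_sub |t| |s|, neg_sq]
      exact hsq_le _ _ (abs_nonneg _) hst
  have hM_ae (t : ℝ) : ∀ᵐ ω ∂P, M |t| ω = 0 := by
    have h0 : ∫ ω, ‖M |t| ω‖ ^ 2 ∂P = 0 := by
      simpa [hM_zero] using
        eq_of_norm_sub_le_mul_sq (f := fun t => ∫ ω, ‖M |t| ω‖ ^ 2 ∂P) habs t 0
    have hsq : Integrable (fun ω => ‖M |t| ω‖ ^ 2) P := by
      refine .of_bound ((hM_meas _ (abs_nonneg t)).norm.pow 2).aestronglyMeasurable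
        ((K * |(|t|)|) ^ 2) (.of_forall fun ω => ?_)
      simpa using pow_le_pow_left₀ (norm_nonneg _) (hM_bdd |t| ω) 2
    filter_upwards [(integral_eq_zero_iff_of_nonneg (fun ω => by positivity) hsq).1 h0] with ω hω
    simpa using hω
  filter_upwards [ae_all_iff.2 fun q : ℚ => hM_ae q] with ω hω
  refine ae_restrict_Ici_eq_zero_of_integral_eq_zero (hloc ω) fun t ht => ?_
  have hcont : Continuous fun t => M |t| ω :=
    (intervalIntegral.continuous_primitive (hint ω) 0).comp continuous_abs
  have hzero := Rat.denseRange_cast.equalizer hcont (continuous_const (y := (0 : E))) (funext hω)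
  simpa [hM, abs_of_nonneg ht] using congrFun hzero t

/-- if `h` is jointly measurable, adapted and bounded and
`M(t) = ∫₀ᵗ h(s) ds` is a martingale, then a.s. `h(s) = 0` for Lebesgue-a.e.
`s ≥ 0`.  In particular, if a process `X` with bounded symbol candidates
`q₁, q₂` is such that both
`t ↦ e^{i⟨u,X(t)⟩} − ∫₀ᵗ e^{i⟨u,X(s)⟩} q_j(X(s),u) ds` are martingales, then
a.s. `q₁(X(s),u) = q₂(X(s),u)` for Lebesgue-a.e. `s ≥ 0`. -/
theorem stmt_17 {Ω : Type*} [m : MeasurableSpace Ω] (P : Measure Ω)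
    [IsProbabilityMeasure P] (ℱ : Filtration ℝ m)
    (h : ℝ → Ω → ℂ)
    (hh_meas : Measurable fun p : ℝ × Ω => h p.1 p.2)
    (hh_adapted : ∀ t : ℝ, StronglyMeasurable[ℱ t] (h t))
    (K : ℝ) (hh_bdd : ∀ s ω, ‖h s ω‖ ≤ K)
    (hM_adapted : ∀ t, 0 ≤ t →
      StronglyMeasurable[ℱ t] fun ω => ∫ s in (0:ℝ)..t, h s ω)
    (hM_int : ∀ t, 0 ≤ t → Integrable (fun ω => ∫ s in (0:ℝ)..t, h s ω) P)
    (hM_mart : ∀ s t : ℝ, 0 ≤ s → s ≤ t →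
      P[(fun ω => ∫ r in (0:ℝ)..t, h r ω)|ℱ s] =ᵐ[P]
        fun ω => ∫ r in (0:ℝ)..s, h r ω) :
    (∀ᵐ ω ∂P, ∀ᵐ s ∂(volume.restrict (Set.Ici (0:ℝ))), h s ω = 0) ∧
    (∀ (d : ℕ) (X : ℝ → Ω → EuclideanSpace ℝ (Fin d))
        (q₁ q₂ : EuclideanSpace ℝ (Fin d) → EuclideanSpace ℝ (Fin d) → ℂ)
        (u : EuclideanSpace ℝ (Fin d)),
      Measurable (fun p : ℝ × Ω => X p.1 p.2) →
      (∀ t : ℝ, StronglyMeasurable[ℱ t] (X t)) →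
      Measurable (fun y => q₁ y u) → Measurable (fun y => q₂ y u) →
      (∃ K₁ : ℝ, ∀ y, ‖q₁ y u‖ ≤ K₁) → (∃ K₂ : ℝ, ∀ y, ‖q₂ y u‖ ≤ K₂) →
      (∀ t, 0 ≤ t → StronglyMeasurable[ℱ t] fun ω =>
        Complex.exp (Complex.I * ((inner ℝ u (X t ω) : ℝ) : ℂ)) -
          ∫ s in (0:ℝ)..t,
            Complex.exp (Complex.I * ((inner ℝ u (X s ω) : ℝ) : ℂ)) * q₁ (X s ω) u) →
      (∀ t, 0 ≤ t → Integrable (fun ω =>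
        Complex.exp (Complex.I * ((inner ℝ u (X t ω) : ℝ) : ℂ)) -
          ∫ s in (0:ℝ)..t,
            Complex.exp (Complex.I * ((inner ℝ u (X s ω) : ℝ) : ℂ)) * q₁ (X s ω) u) P) →
      (∀ s t : ℝ, 0 ≤ s → s ≤ t →
        P[(fun ω => Complex.exp (Complex.I * ((inner ℝ u (X t ω) : ℝ) : ℂ)) -
            ∫ r in (0:ℝ)..t,
              Complex.exp (Complex.I * ((inner ℝ u (X r ω) : ℝ) : ℂ)) * q₁ (X r ω) u)|ℱ s]
          =ᵐ[P]
        fun ω => Complex.exp (Complex.I * ((inner ℝ u (X s ω) : ℝ) : ℂ)) -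
          ∫ r in (0:ℝ)..s,
            Complex.exp (Complex.I * ((inner ℝ u (X r ω) : ℝ) : ℂ)) * q₁ (X r ω) u) →
      (∀ t, 0 ≤ t → StronglyMeasurable[ℱ t] fun ω =>
        Complex.exp (Complex.I * ((inner ℝ u (X t ω) : ℝ) : ℂ)) -
          ∫ s in (0:ℝ)..t,
            Complex.exp (Complex.I * ((inner ℝ u (X s ω) : ℝ) : ℂ)) * q₂ (X s ω) u) →
      (∀ t, 0 ≤ t → Integrable (fun ω =>
        Complex.exp (Complex.I * ((inner ℝ u (X t ω) : ℝ) : ℂ)) -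
          ∫ s in (0:ℝ)..t,
            Complex.exp (Complex.I * ((inner ℝ u (X s ω) : ℝ) : ℂ)) * q₂ (X s ω) u) P) →
      (∀ s t : ℝ, 0 ≤ s → s ≤ t →
        P[(fun ω => Complex.exp (Complex.I * ((inner ℝ u (X t ω) : ℝ) : ℂ)) -
            ∫ r in (0:ℝ)..t,
              Complex.exp (Complex.I * ((inner ℝ u (X r ω) : ℝ) : ℂ)) * q₂ (X r ω) u)|ℱ s]
          =ᵐ[P]
        fun ω => Complex.exp (Complex.I * ((inner ℝ u (X s ω) : ℝ) : ℂ)) -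
          ∫ r in (0:ℝ)..s,
            Complex.exp (Complex.I * ((inner ℝ u (X r ω) : ℝ) : ℂ)) * q₂ (X r ω) u) →
      ∀ᵐ ω ∂P, ∀ᵐ s ∂(volume.restrict (Set.Ici (0:ℝ))),
        q₁ (X s ω) u = q₂ (X s ω) u) := by
  refine ⟨ae_eq_zero_of_martingale_integral hh_meas.stronglyMeasurable hh_bdd hM_adapted hM_mart,
    ?_⟩
  intro d X q₁ q₂ u hX _ hq₁ hq₂ ⟨K₁, hK₁⟩ ⟨K₂, hK₂⟩ hA₁ hI₁ hN₁ hA₂ hI₂ hN₂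
  set e : ℝ → Ω → ℂ := fun s ω =>
    Complex.exp (Complex.I * ((inner ℝ u (X s ω) : ℝ) : ℂ)) with he
  have he_norm (s : ℝ) (ω : Ω) : ‖e s ω‖ = 1 := by
    simp only [he]; rw [mul_comm, Complex.norm_exp_ofReal_mul_I]
  have he_meas : Measurable fun p : ℝ × Ω => e p.1 p.2 :=
    Complex.measurable_exp.comp <| measurable_const.mul <|
      Complex.measurable_ofReal.comp (measurable_const.inner hX)
  have hmeas {q : EuclideanSpace ℝ (Fin d) → EuclideanSpace ℝ (Fin d) → ℂ}
      (hq : Measurable fun y => q y u) :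
      Measurable fun p : ℝ × Ω => e p.1 p.2 * q (X p.1 p.2) u :=
    he_meas.mul (hq.comp hX)
  have hint {q : EuclideanSpace ℝ (Fin d) → EuclideanSpace ℝ (Fin d) → ℂ}
      (hq : Measurable fun y => q y u) {C : ℝ} (hC : ∀ y, ‖q y u‖ ≤ C) (ω : Ω) (t : ℝ) :
      IntervalIntegrable (fun s => e s ω * q (X s ω) u) volume 0 t := by
    refine (intervalIntegrable_const (c := C)).mono_fun
      ((hmeas hq).comp measurable_prodMk_right).aestronglyMeasurable (.of_forall fun s => ?_)
    simpa [he_norm] using (hC (X s ω)).trans (le_abs_self C)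
  have hsub (t : ℝ) : (fun ω => ∫ s in (0:ℝ)..t, (e s ω * q₁ (X s ω) u - e s ω * q₂ (X s ω) u)) =
      (fun ω => e t ω - ∫ s in (0:ℝ)..t, e s ω * q₂ (X s ω) u) -
        fun ω => e t ω - ∫ s in (0:ℝ)..t, e s ω * q₁ (X s ω) u := by
    ext ω
    rw [intervalIntegral.integral_sub (hint hq₁ hK₁ ω t) (hint hq₂ hK₂ ω t), Pi.sub_apply]
    ring
  have hdiff : ∀ᵐ ω ∂P, ∀ᵐ s ∂(volume.restrict (Set.Ici (0:ℝ))),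
      e s ω * q₁ (X s ω) u - e s ω * q₂ (X s ω) u = 0 := by
    refine ae_eq_zero_of_martingale_integral (ℱ := ℱ) (K := K₁ + K₂)
      (h := fun s ω => e s ω * q₁ (X s ω) u - e s ω * q₂ (X s ω) u)
      ((hmeas hq₁).sub (hmeas hq₂)).stronglyMeasurable ?_ ?_ ?_
    · intro s ω
      refine (norm_sub_le _ _).trans ?_
      simpa [he_norm] using add_le_add (hK₁ (X s ω)) (hK₂ (X s ω))
    · intro t ht
      rw [hsub]
      exact (hA₂ t ht).sub (hA₁ t ht)
    · intro s t hs hst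
      rw [hsub, hsub]
      exact (condExp_sub (hI₂ t (hs.trans hst)) (hI₁ t (hs.trans hst)) _).trans
        ((hN₂ s t hs hst).sub (hN₁ s t hs hst))
  filter_upwards [hdiff] with ω hω
  filter_upwards [hω] with s hs
  exact mul_left_cancel₀ (norm_pos_iff.1 (by simp [he_norm])) (sub_eq_zero.1 hs)
end
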